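/- For every integer k ≥ 2, the update family 𝒰_k = {U₁, U₂} with U₁ = {(0,−1),(k,0),(k−1,0)} and U₂ = {(0,−1),(−k,0),(−k+1,0)} is critical, and its difficulty satisfies α(𝒰_k) = k. -/

import Mathlib

open scoped Classical

/-- A site of the two-dimensional lattice. -/
abbrev Site : Type := ℤ × ℤ

/-- An update family: a finite nonempty collection of finite nonempty rules,
none containing the origin. We represent the collection as a `Finset (Finset Site)`
together with this well-formedness predicate. -/
def IsUpdateFamily (𝒰 : Finset (Finset Site)) : Prop :=
  𝒰.Nonempty ∧ ∀ U ∈ 𝒰, U.Nonempty ∧ ((0, 0) : Site) ∉ U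

/-- One step of the bootstrap percolation dynamics. -/
def bpStep (𝒰 : Finset (Finset Site)) (A : Set Site) : Set Site :=
  A ∪ {x : Site | ∃ U ∈ 𝒰, ∀ y ∈ U, x + y ∈ A}

/-- The configuration after `t` steps of the dynamics started from `A`. -/
def bpIter (𝒰 : Finset (Finset Site)) (A : Set Site) : ℕ → Set Site
  | 0 => A
  | n + 1 => bpStep 𝒰 (bpIter 𝒰 A n)

/-- The closure `[A]` of a set `A` under the bootstrap dynamics. -/
def bpClosure (𝒰 : Finset (Finset Site)) (A : Set Site) : Set Site :=
  ⋃ n : ℕ, bpIter 𝒰 A n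

/-- The unit circle `S¹ ⊆ ℝ²`. -/
def sphere2 : Set (ℝ × ℝ) := {u : ℝ × ℝ | u.1 ^ 2 + u.2 ^ 2 = 1}

/-- Inner product of a lattice site with a real vector. -/
def inner2 (x : Site) (u : ℝ × ℝ) : ℝ := (x.1 : ℝ) * u.1 + (x.2 : ℝ) * u.2

/-- The open half-plane `H_u` with outer normal `u`. -/
def halfPlane (u : ℝ × ℝ) : Set Site := {x : Site | inner2 x u < 0}

/-- The lattice line `l_u` through the origin perpendicular to `u`. -/
def lineu (u : ℝ × ℝ) : Set Site := {x : Site | inner2 x u = 0}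

/-- A direction `u` is unstable if some rule lies in `H_u`. -/
def Unstable (𝒰 : Finset (Finset Site)) (u : ℝ × ℝ) : Prop :=
  ∃ U ∈ 𝒰, (U : Set Site) ⊆ halfPlane u

/-- A direction of the unit circle is stable if it is not unstable. -/
def Stable (𝒰 : Finset (Finset Site)) (u : ℝ × ℝ) : Prop :=
  u ∈ sphere2 ∧ ¬ Unstable 𝒰 u

/-- The set of stable directions. -/
def stableSet (𝒰 : Finset (Finset Site)) : Set (ℝ × ℝ) := {u | Stable 𝒰 u}

/-- An isolated stable direction: a stable direction not in the (topological)
closure of the set of other stable directions. -/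
def IsolatedStable (𝒰 : Finset (Finset Site)) (u : ℝ × ℝ) : Prop :=
  Stable 𝒰 u ∧ u ∉ closure (stableSet 𝒰 \ {u})

/-- The open semicircle of the unit circle centred at the direction `v`. -/
def openSemicircle (v : ℝ × ℝ) : Set (ℝ × ℝ) :=
  {u ∈ sphere2 | 0 < u.1 * v.1 + u.2 * v.2}

/-- A family is supercritical if some open semicircle consists of unstable directions. -/
def Supercritical (𝒰 : Finset (Finset Site)) : Prop :=
  ∃ v ∈ sphere2, ∀ u ∈ openSemicircle v, Unstable 𝒰 u

/-- A family is critical if it is not supercritical and some open semicircle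
contains only finitely many stable directions. -/
def Critical (𝒰 : Finset (Finset Site)) : Prop :=
  ¬ Supercritical 𝒰 ∧ ∃ v ∈ sphere2, (stableSet 𝒰 ∩ openSemicircle v).Finite

/-- The difficulty `α(u)` of a direction: `0` for unstable directions, `∞` for
non-isolated stable directions, and for isolated stable directions the minimum
cardinality of a finite `Z ⊆ ℤ² ∖ H_u` such that `[H_u ∪ Z] ∖ H_u` is infinite. -/
noncomputable def dirDifficulty (𝒰 : Finset (Finset Site)) (u : ℝ × ℝ) : ℕ∞ :=
  if Unstable 𝒰 u then 0
  else if IsolatedStable 𝒰 u then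
    sInf {n : ℕ∞ | ∃ Z : Finset Site, (∀ z ∈ Z, z ∉ halfPlane u) ∧
      (bpClosure 𝒰 (halfPlane u ∪ (Z : Set Site)) \ halfPlane u).Infinite ∧ n = Z.card}
  else ⊤

/-- The difficulty `α(𝒰)` of an update family. -/
noncomputable def difficulty (𝒰 : Finset (Finset Site)) : ℕ∞ :=
  ⨅ v ∈ sphere2, ⨆ u ∈ openSemicircle v, dirDifficulty 𝒰 u

/-- The diameter `D` of an update family: `2 · max{‖x‖_∞ : x ∈ ⋃ U ∈ 𝒰, U}`. -/
def famDiam (𝒰 : Finset (Finset Site)) : ℕ :=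
  2 * 𝒰.sup (fun U => U.sup (fun x => max x.1.natAbs x.2.natAbs))

/-- The update family `𝒰_k = {U₁, U₂}` with `U₁ = {(0,−1),(k,0),(k−1,0)}` and
`U₂ = {(0,−1),(−k,0),(−k+1,0)}`. -/
def famUk (k : ℕ) : Finset (Finset Site) :=
  { ({((0 : ℤ), (-1 : ℤ)), ((k : ℤ), (0 : ℤ)), ((k : ℤ) - 1, (0 : ℤ))} : Finset Site),
    ({((0 : ℤ), (-1 : ℤ)), (-(k : ℤ), (0 : ℤ)), (-(k : ℤ) + 1, (0 : ℤ))} : Finset Site) }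

/-- A set containing `A` and closed under the dynamics contains the closure of `A`. -/
theorem bpClosure_subset {𝒰 : Finset (Finset Site)} {A T : Set Site} (hA : A ⊆ T)
    (hT : ∀ x, ∀ U ∈ 𝒰, (∀ y ∈ U, x + y ∈ T) → x ∈ T) : bpClosure 𝒰 A ⊆ T := by
  refine Set.iUnion_subset fun n => ?_
  induction n with
  | zero => exact hA
  | succ n ih =>
    rintro x (hx | ⟨U, hU, hx⟩)
    · exact ih hx
    · exact hT x U hU fun y hy => ih (hx y hy)

/-- Iterating the dynamics only adds sites. -/
theorem bpIter_mono (𝒰 : Finset (Finset Site)) (A : Set Site) : Monotone (bpIter 𝒰 A) :=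
  monotone_nat_of_le_succ fun _ => Set.subset_union_left

theorem subset_bpClosure (𝒰 : Finset (Finset Site)) (A : Set Site) : A ⊆ bpClosure 𝒰 A :=
  fun _ hx => Set.mem_iUnion.2 ⟨0, hx⟩

/-- The closure is closed under every rule. -/
theorem mem_bpClosure_of_rule {𝒰 : Finset (Finset Site)} {A : Set Site} {U : Finset Site}
    (hU : U ∈ 𝒰) {x : Site} (hx : ∀ y ∈ U, x + y ∈ bpClosure 𝒰 A) : x ∈ bpClosure 𝒰 A := by
  have hx' : ∀ y ∈ U, ∃ n, x + y ∈ bpIter 𝒰 A n := fun y hy => Set.mem_iUnion.1 (hx y hy)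
  choose! n hn using hx'
  refine Set.mem_iUnion.2 ⟨U.sup n + 1, Or.inr ⟨U, hU, fun y hy => ?_⟩⟩
  exact bpIter_mono 𝒰 A (Finset.le_sup (f := n) hy) (hn y hy)

theorem halfPlane_up : halfPlane (0, 1) = {x : Site | x.2 < 0} := by
  ext x
  simp [halfPlane, inner2]

/-- For `k ≥ 2`, a direction is unstable for `famUk k` exactly when it points strictly upwards
and is not vertical. -/
theorem unstable_famUk_iff {k : ℕ} (hk : 2 ≤ k) (u : ℝ × ℝ) :
    Unstable (famUk k) u ↔ 0 < u.2 ∧ u.1 ≠ 0 := by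
  have hk' : (2 : ℝ) ≤ k := by exact_mod_cast hk
  simp only [Unstable, famUk, Finset.mem_insert, Finset.mem_singleton, exists_eq_or_imp,
    exists_eq_left, Finset.coe_insert, Finset.coe_singleton, Set.insert_subset_iff,
    Set.singleton_subset_iff, halfPlane, inner2, Set.mem_ofPred_eq]
  push_cast
  constructor
  · rintro (⟨h1, h2, h3⟩ | ⟨h1, h2, h3⟩) <;>
    · refine ⟨by linarith, fun h => ?_⟩
      simp [h] at h2
  · rintro ⟨h1, h2⟩
    rcases lt_or_gt_of_ne h2 with h | h
    · left
      refine ⟨by linarith, by nlinarith, by nlinarith⟩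
    · right
      refine ⟨by linarith, by nlinarith, by nlinarith⟩

theorem stable_famUk_iff {k : ℕ} (hk : 2 ≤ k) (u : ℝ × ℝ) :
    Stable (famUk k) u ↔ u ∈ sphere2 ∧ (u.2 ≤ 0 ∨ u.1 = 0) := by
  rw [Stable, unstable_famUk_iff hk, not_and_or, not_lt, not_not]

theorem up_mem_sphere2 : ((0, 1) : ℝ × ℝ) ∈ sphere2 := by
  simp [sphere2]

theorem eq_up_of_stable {k : ℕ} (hk : 2 ≤ k) {u : ℝ × ℝ} (hu : Stable (famUk k) u)
    (h : 0 < u.2) : u = (0, 1) := by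
  obtain ⟨hs, h' | h'⟩ := (stable_famUk_iff hk u).1 hu
  · linarith
  · have hs' : u.1 ^ 2 + u.2 ^ 2 = 1 := hs
    refine Prod.ext h' ?_
    show u.2 = 1
    rw [h'] at hs'
    nlinarith

theorem isolatedStable_up {k : ℕ} (hk : 2 ≤ k) : IsolatedStable (famUk k) (0, 1) := by
  refine ⟨(stable_famUk_iff hk _).2 ⟨up_mem_sphere2, Or.inr rfl⟩, fun hcl => ?_⟩
  have hopen : IsOpen {u : ℝ × ℝ | 0 < u.2} := isOpen_lt continuous_const continuous_snd
  obtain ⟨u, hu, hs, hne⟩ := mem_closure_iff.1 hcl _ hopen (one_pos : (0 : ℝ) < 1)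
  exact hne (eq_up_of_stable hk hs hu)

/-- The end point of a curve in the circle through stable directions is not isolated. -/
theorem mem_closure_of_curve {S : Set (ℝ × ℝ)} {w : ℝ → ℝ × ℝ} (hw : Continuous w)
    (h : ∀ t, 0 < t → t < 1 → w t ∈ S \ {w 0}) : w 0 ∈ closure (S \ {w 0}) := by
  refine mem_closure_of_tendsto (b := nhdsWithin (0 : ℝ) (Set.Ioi 0))
    (hw.continuousAt.tendsto.mono_left nhdsWithin_le_nhds) ?_
  filter_upwards [Ioo_mem_nhdsGT (one_pos : (0 : ℝ) < 1)] with t ht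
  exact h t ht.1 ht.2

theorem dirDifficulty_eq_top_of_curve {k : ℕ} (hk : 2 ≤ k) {w : ℝ → ℝ × ℝ} (hw : Continuous w)
    (h0 : (w 0).2 ≤ 0) (h : ∀ t, 0 < t → t < 1 → w t ∈ sphere2 ∧ (w t).2 ≤ 0 ∧ w t ≠ w 0) :
    dirDifficulty (famUk k) (w 0) = ⊤ := by
  have hcl : w 0 ∈ closure (stableSet (famUk k) \ {w 0}) :=
    mem_closure_of_curve hw fun t ht ht' =>
      have ⟨h1, h2, h3⟩ := h t ht ht'
      ⟨(stable_famUk_iff hk _).2 ⟨h1, Or.inl h2⟩, h3⟩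
  rw [dirDifficulty, if_neg fun hu => ((unstable_famUk_iff hk _).1 hu).1.not_ge h0,
    if_neg fun hi => hi.2 hcl]

theorem dirDifficulty_horizontal {k : ℕ} (hk : 2 ≤ k) {s : ℝ} (hs : s ^ 2 = 1) :
    dirDifficulty (famUk k) (s, 0) = ⊤ := by
  have h := dirDifficulty_eq_top_of_curve hk (w := fun t => (s * Real.cos t, -Real.sin t))
    (by fun_prop) (by simp) fun t ht ht' => by
      have hsin : 0 < Real.sin t :=
        Real.sin_pos_of_pos_of_lt_pi ht (ht'.trans (by linarith [Real.pi_gt_three]))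
      refine ⟨?_, by simpa using hsin.le, fun h => ?_⟩
      · show (s * Real.cos t) ^ 2 + (-Real.sin t) ^ 2 = 1
        linear_combination Real.cos t ^ 2 * hs + Real.sin_sq_add_cos_sq t
      · simp only [Prod.mk.injEq, Real.sin_zero, neg_zero] at h
        linarith [h.2]
  simpa using h

theorem dirDifficulty_down {k : ℕ} (hk : 2 ≤ k) : dirDifficulty (famUk k) (0, -1) = ⊤ := by
  have h := dirDifficulty_eq_top_of_curve hk (w := fun t => (Real.sin t, -Real.cos t))
    (by fun_prop) (by simp) fun t ht ht' => by
      have hsin : 0 < Real.sin t :=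
        Real.sin_pos_of_pos_of_lt_pi ht (ht'.trans (by linarith [Real.pi_gt_three]))
      have hcos : 0 < Real.cos t :=
        Real.cos_pos_of_mem_Ioo ⟨by linarith [Real.pi_gt_three], by linarith [Real.pi_gt_three]⟩
      refine ⟨?_, by simpa using hcos.le, fun h => ?_⟩
      · show Real.sin t ^ 2 + (-Real.cos t) ^ 2 = 1
        linear_combination Real.sin_sq_add_cos_sq t
      · simp only [Prod.mk.injEq, Real.sin_zero] at h
        linarith [h.1]
  simpa using h

/-- Every open semicircle other than the upper one contains a direction of infinite difficulty. -/
theorem exists_dirDifficulty_eq_top {k : ℕ} (hk : 2 ≤ k) {v : ℝ × ℝ} (hv : v ∈ sphere2)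
    (hne : v ≠ (0, 1)) : ∃ u ∈ openSemicircle v, dirDifficulty (famUk k) u = ⊤ := by
  have hv' : v.1 ^ 2 + v.2 ^ 2 = 1 := hv
  rcases lt_trichotomy v.1 0 with h | h | h
  · exact ⟨(-1, 0), ⟨by simp [sphere2], by simpa using h⟩, dirDifficulty_horizontal hk (by norm_num)⟩
  · have h2 : v.2 = -1 := by
      rw [h] at hv'
      have hv2 : (v.2 - 1) * (v.2 + 1) = 0 := by linear_combination hv'
      rcases mul_eq_zero.1 hv2 with h3 | h3
      · exact absurd (Prod.ext h (by linarith)) hne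
      · linarith
    exact ⟨(0, -1), ⟨by simp [sphere2], by simp [h2]⟩, dirDifficulty_down hk⟩
  · exact ⟨(1, 0), ⟨by simp [sphere2], by simpa using h⟩, dirDifficulty_horizontal hk (by norm_num)⟩

/-- Fewer than `k` sites miss a residue class of columns modulo `k`. -/
theorem exists_missed_residue {k : ℕ} {Z : Finset Site} (hZ : Z.card < k) :
    ∃ c : ℤ, ∀ z ∈ Z, (z.1 - c) % (k : ℤ) ≠ 0 := by
  have hcard : (Z.image fun z => z.1 % (k : ℤ)).card < (Finset.Ico (0 : ℤ) k).card := by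
    simpa using Finset.card_image_le.trans_lt hZ
  obtain ⟨c, hc, hcZ⟩ := Finset.exists_mem_notMem_of_card_lt_card hcard
  rw [Finset.mem_Ico] at hc
  refine ⟨c, fun z hz h => hcZ (Finset.mem_image.2 ⟨z, hz, ?_⟩)⟩
  rw [Int.emod_emod_of_dvd _ dvd_rfl |>.symm, (Int.emod_eq_emod_iff_emod_sub_eq_zero).2 h,
    Int.emod_emod_of_dvd _ dvd_rfl, Int.emod_eq_of_lt hc.1 hc.2]

/-- A step of size `k - 1` preserves the sum of quotient and remainder modulo `k`, unless it
starts in the residue class zero. -/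
theorem ediv_add_emod_add_pred {k a : ℤ} (hk : 0 < k) (ha : a % k ≠ 0) :
    (a + (k - 1)) / k + (a + (k - 1)) % k = a / k + a % k := by
  have h0 := Int.emod_nonneg a hk.ne'
  have h1 := Int.emod_lt_of_pos a hk
  have h2 := Int.mul_ediv_add_emod a k
  have h3 : a + (k - 1) = (a % k - 1) + k * (a / k + 1) := by linear_combination -h2
  rw [h3, Int.add_mul_ediv_left _ _ hk.ne', Int.add_mul_emod_self_left,
    Int.ediv_eq_zero_of_lt (by omega) (by omega), Int.emod_eq_of_lt (by omega) (by omega)]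
  ring

theorem finite_bpClosure_diff_of_card_lt {k : ℕ} {Z : Finset Site} (hZ : Z.card < k) :
    (bpClosure (famUk k) (halfPlane (0, 1) ∪ (Z : Set Site)) \ halfPlane (0, 1)).Finite := by
  obtain ⟨c, hc⟩ := exists_missed_residue hZ
  have hk : (0 : ℤ) < k := by omega
  let f : ℤ → ℤ := fun x => (x - c) / (k : ℤ) + (x - c) % (k : ℤ)
  let F : Finset ℤ := Z.image fun z => f z.1
  let Y : Finset ℤ := Z.image Prod.snd
  let T : Set Site := {x | x.2 < 0 ∨ ((x.1 - c) % (k : ℤ) ≠ 0 ∧ f x.1 ∈ F ∧ x.2 ∈ Y)}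
  have hT : bpClosure (famUk k) (halfPlane (0, 1) ∪ (Z : Set Site)) ⊆ T := by
    refine bpClosure_subset ?_ ?_
    · rintro x (hx | hx)
      · rw [halfPlane_up] at hx
        exact Or.inl hx
      · exact Or.inr ⟨hc x hx, Finset.mem_image_of_mem (fun z : Site => f z.1) hx,
          Finset.mem_image_of_mem _ hx⟩
    · rintro ⟨x, y⟩ U hU h
      rcases lt_or_ge y 0 with hy | hy
      · exact Or.inl hy
      right
      simp only [famUk, Finset.mem_insert, Finset.mem_singleton] at hU
      rcases hU with rfl | rfl
      · obtain ⟨h1, -, h3⟩ := (h (k, 0) (by simp)).resolve_left (by simpa using hy)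
        obtain ⟨-, h2, -⟩ := (h ((k : ℤ) - 1, 0) (by simp)).resolve_left (by simpa using hy)
        have e1 : x + (k : ℤ) - c = (x - c) + k := by ring
        simp only [Prod.mk_add_mk, e1, Int.add_emod_right, add_zero] at h1 h2 h3
        refine ⟨h1, ?_, h3⟩
        have e2 : x + ((k : ℤ) - 1) - c = (x - c) + (k - 1) := by ring
        simpa only [f, e2, ediv_add_emod_add_pred hk h1] using h2
      · obtain ⟨h1, -, h3⟩ := (h (-k, 0) (by simp)).resolve_left (by simpa using hy)
        obtain ⟨h4, h2, -⟩ := (h (-(k : ℤ) + 1, 0) (by simp)).resolve_left (by simpa using hy)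
        have e1 : x - c = (x + -(k : ℤ) - c) + k := by ring
        have e2 : x - c = (x + (-(k : ℤ) + 1) - c) + (k - 1) := by ring
        simp only [Prod.mk_add_mk, add_zero] at h1 h2 h3 h4
        refine ⟨by simpa only [e1, Int.add_emod_right] using h1, ?_, h3⟩
        show (x - c) / (k : ℤ) + (x - c) % (k : ℤ) ∈ F
        rw [e2, ediv_add_emod_add_pred hk h4]
        exact h2
  refine ((F ×ˢ Finset.Ico (0 : ℤ) k ×ˢ Y).image
    fun p => ((c + k * (p.1 - p.2.1) + p.2.1, p.2.2) : Site)).finite_toSet.subset ?_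
  rintro ⟨x, y⟩ ⟨hx, hxH⟩
  rw [halfPlane_up] at hxH
  obtain ⟨-, hF, hY⟩ := (hT hx).resolve_left hxH
  refine Finset.mem_coe.2 (Finset.mem_image.2 ⟨(f x, (x - c) % k, y), ?_, ?_⟩)
  · simp only [Finset.mem_product, Finset.mem_Ico]
    exact ⟨hF, ⟨Int.emod_nonneg _ hk.ne', Int.emod_lt_of_pos _ hk⟩, hY⟩
  · refine Prod.ext ?_ rfl
    simp only [f]
    linear_combination Int.mul_ediv_add_emod (x - c) k

/-- An interval of `k` consecutive sites on the boundary line infects a whole half-line. -/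
theorem infinite_bpClosure_diff_interval {k : ℕ} (hk : 2 ≤ k) :
    (bpClosure (famUk k) (halfPlane (0, 1) ∪
      ((Finset.range k).image fun n : ℕ => ((n : ℤ), (0 : ℤ)) : Finset Site)) \
        halfPlane (0, 1)).Infinite := by
  have hmem : ∀ n : ℕ, ((n : ℤ), (0 : ℤ)) ∈ bpClosure (famUk k) (halfPlane (0, 1) ∪
      ((Finset.range k).image fun n : ℕ => ((n : ℤ), (0 : ℤ)) : Finset Site)) := by
    intro n
    induction n using Nat.strong_induction_on with
    | _ n ih =>
      rcases lt_or_ge n k with hn | hn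
      · exact subset_bpClosure _ _ (Or.inr (Finset.mem_coe.2
          (Finset.mem_image.2 ⟨n, Finset.mem_range.2 hn, rfl⟩)))
      · refine mem_bpClosure_of_rule
          (U := {((0 : ℤ), (-1 : ℤ)), (-(k : ℤ), (0 : ℤ)), (-(k : ℤ) + 1, (0 : ℤ))})
          (by simp [famUk]) fun y hy => ?_
        simp only [Finset.mem_insert, Finset.mem_singleton] at hy
        rcases hy with rfl | rfl | rfl
        · refine subset_bpClosure _ _ (Or.inl ?_)
          rw [halfPlane_up]
          simp
        · convert ih (n - k) (by omega) using 1
          simp only [Prod.mk_add_mk, Prod.mk.injEq, add_zero, and_true]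
          omega
        · convert ih (n - k + 1) (by omega) using 1
          simp only [Prod.mk_add_mk, Prod.mk.injEq, add_zero, and_true]
          omega
  refine Set.infinite_of_injective_forall_mem (f := fun n : ℕ => (((n : ℤ), (0 : ℤ)) : Site))
    (fun a b h => by simpa using h) fun n => ⟨hmem n, ?_⟩
  rw [halfPlane_up]
  simp

theorem dirDifficulty_up {k : ℕ} (hk : 2 ≤ k) : dirDifficulty (famUk k) (0, 1) = k := by
  rw [dirDifficulty, if_neg (isolatedStable_up hk).1.2, if_pos (isolatedStable_up hk)]
  refine le_antisymm (sInf_le ⟨_, ?_, infinite_bpClosure_diff_interval hk, ?_⟩) (le_sInf ?_)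
  · intro z hz
    obtain ⟨n, -, rfl⟩ := Finset.mem_image.1 hz
    rw [halfPlane_up]
    simp
  · rw [Finset.card_image_of_injective _ fun a b h => by simpa using h, Finset.card_range]
  · rintro n ⟨Z, -, hinf, rfl⟩
    by_contra! h
    exact hinf (finite_bpClosure_diff_of_card_lt (by exact_mod_cast h))

theorem not_supercritical_famUk {k : ℕ} (hk : 2 ≤ k) : ¬ Supercritical (famUk k) := by
  rintro ⟨v, hv, h⟩
  rcases eq_or_ne v (0, 1) with rfl | hne
  · exact (isolatedStable_up hk).1.2 (h _ ⟨up_mem_sphere2, by simp⟩)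
  · obtain ⟨u, hu, htop⟩ := exists_dirDifficulty_eq_top hk hv hne
    rw [dirDifficulty, if_pos (h u hu)] at htop
    exact ENat.top_ne_zero htop.symm

/-- for every integer `k ≥ 2` the family `𝒰_k` is critical and its
difficulty is `α(𝒰_k) = k`. -/
theorem famUk_critical_difficulty (k : ℕ) (hk : 2 ≤ k) :
    Critical (famUk k) ∧ difficulty (famUk k) = (k : ℕ∞) := by
  refine ⟨⟨not_supercritical_famUk hk, (0, 1), up_mem_sphere2, ?_⟩, le_antisymm ?_ ?_⟩
  · refine (Set.finite_singleton ((0, 1) : ℝ × ℝ)).subset ?_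
    rintro u ⟨hu, -, hpos⟩
    exact eq_up_of_stable hk hu (by simpa using hpos)
  · refine iInf₂_le_of_le (0, 1) up_mem_sphere2 (iSup₂_le ?_)
    rintro u ⟨hu, hpos⟩
    by_cases hun : Unstable (famUk k) u
    · rw [dirDifficulty, if_pos hun]
      exact zero_le
    · rw [eq_up_of_stable hk ⟨hu, hun⟩ (by simpa using hpos), dirDifficulty_up hk]
  · refine le_iInf₂ fun v hv => ?_
    rcases eq_or_ne v (0, 1) with rfl | hne
    · exact le_iSup₂_of_le (0, 1) ⟨up_mem_sphere2, by simp⟩ (dirDifficulty_up hk).ge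
    · obtain ⟨u, hu, htop⟩ := exists_dirDifficulty_eq_top hk hv hne
      exact le_iSup₂_of_le u hu (htop ▸ le_top)
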